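/- Let L₁ be an m×m real matrix with L₁L₁ᵀ = Σ_obs⁻¹ and L₂ a d×d real matrix with L₂L₂ᵀ = Σ_pr⁻¹. Consider the map T : ℝ^m × ℝ^d → ℝ^d given by T(ζ, γ) = Σ_po·(AᵀΣ_obs⁻¹y + Σ_pr⁻¹μ_pr + AᵀL₁ζ + L₂γ). Then the pushforward under T of the product of the standard Gaussian measures on ℝ^m and ℝ^d equals the probability measure on ℝ^d with Lebesgue density x ↦ (2π)^{−d/2}(det Σ_po)^{−1/2} exp(−(1/2)(x−μ_po)ᵀΣ_po⁻¹(x−μ_po)); i.e., the linear randomize-then-optimize sample x = T(ζ,γ) with independent standard Gaussian ζ, γ is distributed as the Gaussian posterior component N(μ_po, Σ_po). (Correctness of the linear RTO sampler, appendix B.) -/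

import Mathlib

open Matrix MeasureTheory Real

/-- The standard Gaussian measure on `Fin n → ℝ`, given by its Lebesgue density. -/
noncomputable def stdGaussianPi (n : ℕ) : Measure (Fin n → ℝ) :=
  volume.withDensity (fun u : Fin n → ℝ =>
    ENNReal.ofReal ((2 * Real.pi) ^ (-(n : ℝ) / 2) * Real.exp (-(∑ i, u i ^ 2) / 2)))

lemma measurable_stdGaussianPi_density (n : ℕ) :
    Measurable (fun u : Fin n → ℝ =>
      ENNReal.ofReal ((2 * Real.pi) ^ (-(n : ℝ) / 2) * Real.exp (-(∑ i, u i ^ 2) / 2))) := by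
  fun_prop

instance isFiniteMeasure_stdGaussianPi (n : ℕ) : IsFiniteMeasure (stdGaussianPi n) := by
  refine isFiniteMeasure_withDensity_ofReal (Integrable.hasFiniteIntegral ?_)
  have h := GaussianFourier.integrable_cexp_neg_mul_sum_add (ι := Fin n) (b := 1 / 2)
    (by norm_num) 0
  refine (h.norm.congr ?_).const_mul _
  refine Filter.Eventually.of_forall fun u => ?_
  have : -(1 / 2 : ℂ) * ∑ i, (u i : ℂ) ^ 2 + ∑ i, (0 : Fin n → ℂ) i * u i
      = ((-(∑ i, u i ^ 2) / 2 : ℝ) : ℂ) := by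
    push_cast
    simp
    ring
  simp only [this, Complex.norm_exp, Complex.ofReal_re]

lemma integral_cexp_dotProduct_stdGaussianPi {n : ℕ} (v : Fin n → ℝ) :
    ∫ u, Complex.exp (((v ⬝ᵥ u : ℝ) : ℂ) * Complex.I) ∂(stdGaussianPi n)
      = Complex.exp ((-(v ⬝ᵥ v) / 2 : ℝ) : ℂ) := by
  have h := GaussianFourier.integral_cexp_neg_mul_sum_add (ι := Fin n) (b := 1 / 2)
    (by norm_num) (fun i => v i * Complex.I)
  rw [stdGaussianPi, integral_withDensity_eq_integral_toReal_smul
    (measurable_stdGaussianPi_density n) (by simp)]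
  have hpos : (0 : ℝ) < 2 * Real.pi := by positivity
  have hcongr : ∀ u : Fin n → ℝ,
      (ENNReal.ofReal ((2 * Real.pi) ^ (-(n : ℝ) / 2) * Real.exp (-(∑ i, u i ^ 2) / 2))).toReal •
        Complex.exp (((v ⬝ᵥ u : ℝ) : ℂ) * Complex.I)
      = (((2 * Real.pi) ^ (-(n : ℝ) / 2) : ℝ) : ℂ) *
        Complex.exp (-(1 / 2) * ∑ i, (u i : ℂ) ^ 2 + ∑ i, v i * Complex.I * u i) := by
    intro u
    rw [ENNReal.toReal_ofReal (by positivity), Complex.real_smul, Complex.ofReal_mul, mul_assoc,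
      Complex.ofReal_exp, ← Complex.exp_add]
    congr 2
    simp only [dotProduct]
    push_cast
    rw [Finset.sum_mul]
    congr 1
    · ring
    · exact Finset.sum_congr rfl fun i _ => by ring
  simp_rw [hcongr]
  rw [integral_const_mul, h, ← mul_assoc]
  have hc : (((2 * Real.pi) ^ (-(n : ℝ) / 2) : ℝ) : ℂ)
      * ((Real.pi : ℂ) / (1 / 2)) ^ ((Fintype.card (Fin n) : ℂ) / 2) = 1 := by
    have : ((Real.pi : ℂ) / (1 / 2)) ^ ((Fintype.card (Fin n) : ℂ) / 2)
        = (((2 * Real.pi) ^ ((n : ℝ) / 2) : ℝ) : ℂ) := by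
      rw [Complex.ofReal_cpow hpos.le, Fintype.card_fin]
      push_cast
      congr 1
      ring
    rw [this, ← Complex.ofReal_mul, ← Real.rpow_add hpos]
    simp [neg_div]
  rw [hc, one_mul]
  congr 1
  simp only [mul_pow, Complex.I_sq, dotProduct]
  push_cast
  rw [← Finset.sum_mul]
  simp only [← pow_two]
  ring

lemma map_affine_stdGaussianPi {n : ℕ} (μ : Fin n → ℝ) (R S : Matrix (Fin n) (Fin n) ℝ)
    (hR : R.det ≠ 0) (hS : S = R * Rᵀ) :
    (stdGaussianPi n).map (fun u => μ + R *ᵥ u)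
      = volume.withDensity (fun x : Fin n → ℝ =>
        ENNReal.ofReal ((2 * Real.pi) ^ (-(n : ℝ) / 2) * S.det ^ (-(1 : ℝ) / 2)
          * Real.exp (-(1 / 2) * ((x - μ) ⬝ᵥ S⁻¹ *ᵥ (x - μ))))) := by
  have hlin : Measurable (fun u : Fin n → ℝ => R *ᵥ u) :=
    (Continuous.matrix_mulVec continuous_const continuous_id).measurable
  have he : Measurable (fun u : Fin n → ℝ => μ + R *ᵥ u) := hlin.const_add μ
  have hvol : (volume : Measure (Fin n → ℝ))
      = ENNReal.ofReal |R.det| • Measure.map (fun u : Fin n → ℝ => μ + R *ᵥ u) volume := by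
    have h1 := Real.map_matrix_volume_pi_eq_smul_volume_pi hR
    have h2 : Measure.map (fun u : Fin n → ℝ => μ + R *ᵥ u) volume
        = Measure.map (fun x => μ + x) (Measure.map (toLin' R) volume) := by
      exact (Measure.map_map (measurable_const_add μ) hlin).symm
    rw [h2, h1, Measure.map_smul, map_add_left_eq_self, smul_smul,
      ← ENNReal.ofReal_mul (abs_nonneg _), ← abs_mul, mul_inv_cancel₀ hR]
    simp
  have hcont : Continuous (fun x : Fin n → ℝ => (x - μ) ⬝ᵥ S⁻¹ *ᵥ (x - μ)) :=
    Continuous.dotProduct (by fun_prop)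
      (Continuous.matrix_mulVec continuous_const (by fun_prop))
  have hf : Measurable (fun x : Fin n → ℝ =>
        ENNReal.ofReal ((2 * Real.pi) ^ (-(n : ℝ) / 2) * S.det ^ (-(1 : ℝ) / 2)
          * Real.exp (-(1 / 2) * ((x - μ) ⬝ᵥ S⁻¹ *ᵥ (x - μ))))) := by
    have := hcont.measurable
    fun_prop
  have hunit : IsUnit R.det := hR.isUnit
  have hquad : ∀ u : Fin n → ℝ, (R *ᵥ u) ⬝ᵥ S⁻¹ *ᵥ (R *ᵥ u) = ∑ i, u i ^ 2 := by
    intro u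
    have h1 : Rᵀ * S⁻¹ * R = 1 := by
      rw [hS, Matrix.mul_inv_rev, ← mul_assoc, Matrix.mul_nonsing_inv _ (by simpa using hunit),
        one_mul, Matrix.nonsing_inv_mul _ hunit]
    rw [← vecMul_transpose R u, ← dotProduct_mulVec, vecMul_transpose, mulVec_mulVec,
      mulVec_mulVec, h1, one_mulVec]
    simp [dotProduct, pow_two]
  have hdet : |R.det| * S.det ^ (-(1 : ℝ) / 2) = 1 := by
    have habs : 0 < |R.det| := abs_pos.mpr hR
    have : S.det = |R.det| ^ (2 : ℝ) := by
      rw [hS, det_mul, det_transpose, Real.rpow_two, sq_abs, pow_two]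
    rw [this, ← Real.rpow_mul habs.le]
    norm_num [Real.rpow_neg_one, habs.ne']
  ext s hs
  rw [Measure.map_apply he hs, stdGaussianPi, withDensity_apply _ (he hs), withDensity_apply _ hs]
  conv_rhs => rw [hvol]
  rw [Measure.restrict_smul, lintegral_smul_measure, setLIntegral_map hs hf he, smul_eq_mul,
    ← lintegral_const_mul' _ _ ENNReal.ofReal_ne_top]
  refine lintegral_congr fun u => ?_
  simp only [add_sub_cancel_left, hquad]
  rw [← ENNReal.ofReal_mul (abs_nonneg _)]
  congr 1
  calc (2 * Real.pi) ^ (-(n : ℝ) / 2) * Real.exp (-(∑ i, u i ^ 2) / 2)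
      = (|R.det| * S.det ^ (-(1 : ℝ) / 2)) *
          ((2 * Real.pi) ^ (-(n : ℝ) / 2) * Real.exp (-(∑ i, u i ^ 2) / 2)) := by
        rw [hdet, one_mul]
    _ = _ := by
        rw [show -(∑ i, u i ^ 2) / 2 = -(1 / 2) * ∑ i, u i ^ 2 by ring]
        ring

open scoped MatrixOrder Matrix.Norms.L2Operator in
lemma Matrix.PosDef.exists_eq_mul_transpose {n : ℕ} {S : Matrix (Fin n) (Fin n) ℝ}
    (hS : S.PosDef) : ∃ R : Matrix (Fin n) (Fin n) ℝ, R.det ≠ 0 ∧ S = R * Rᵀ := by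
  obtain ⟨B, hB⟩ := CStarAlgebra.nonneg_iff_eq_star_mul_self.mp hS.posSemidef.nonneg
  have hB' : S = Bᵀ * B := by
    rw [hB, star_eq_conjTranspose, conjTranspose_eq_transpose_of_trivial]
  refine ⟨Bᵀ, fun h => hS.det_pos.ne' ?_, by rw [transpose_transpose, hB']⟩
  rw [hB', det_mul, h, zero_mul]

lemma strongDual_pi_apply_eq_dotProduct {n : ℕ} (L : StrongDual ℝ (Fin n → ℝ)) (x : Fin n → ℝ) :
    L x = (fun i => L (Pi.single i 1)) ⬝ᵥ x := by
  conv_lhs => rw [pi_eq_sum_univ' x]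
  simp [dotProduct, map_sum, mul_comm]

lemma charFunDual_map_affine_stdGaussianPi {n k : ℕ} (μ : Fin k → ℝ)
    (R : Matrix (Fin k) (Fin n) ℝ) (L : StrongDual ℝ (Fin k → ℝ)) (w : Fin k → ℝ)
    (hw : ∀ x, L x = w ⬝ᵥ x) :
    charFunDual ((stdGaussianPi n).map (fun u => μ + R *ᵥ u)) L
      = Complex.exp ((w ⬝ᵥ μ : ℝ) * Complex.I)
        * Complex.exp ((-(w ⬝ᵥ (R * Rᵀ) *ᵥ w) / 2 : ℝ) : ℂ) := by
  have he : Continuous (fun u : Fin n → ℝ => μ + R *ᵥ u) :=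
    continuous_const.add (Continuous.matrix_mulVec continuous_const continuous_id)
  rw [charFunDual_apply, integral_map he.aemeasurable
    (Continuous.aestronglyMeasurable (by fun_prop))]
  have h : ∀ u : Fin n → ℝ, Complex.exp (L (μ + R *ᵥ u) * Complex.I)
      = Complex.exp ((w ⬝ᵥ μ : ℝ) * Complex.I)
        * Complex.exp (((Rᵀ *ᵥ w) ⬝ᵥ u : ℝ) * Complex.I) := by
    intro u
    rw [hw, dotProduct_add, dotProduct_mulVec, ← mulVec_transpose, ← Complex.exp_add,
      Complex.ofReal_add, add_mul]
  simp_rw [h]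
  rw [integral_const_mul, integral_cexp_dotProduct_stdGaussianPi, ← mulVec_mulVec,
    dotProduct_mulVec w, ← mulVec_transpose]

lemma charFunDual_map_affine_prod_stdGaussianPi {m n k : ℕ} (μ : Fin k → ℝ)
    (P : Matrix (Fin k) (Fin m) ℝ) (Q : Matrix (Fin k) (Fin n) ℝ)
    (L : StrongDual ℝ (Fin k → ℝ)) (w : Fin k → ℝ) (hw : ∀ x, L x = w ⬝ᵥ x) :
    charFunDual (((stdGaussianPi m).prod (stdGaussianPi n)).map
        (fun p => μ + P *ᵥ p.1 + Q *ᵥ p.2)) L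
      = Complex.exp ((w ⬝ᵥ μ : ℝ) * Complex.I)
        * Complex.exp ((-(w ⬝ᵥ (P * Pᵀ + Q * Qᵀ) *ᵥ w) / 2 : ℝ) : ℂ) := by
  have he : Continuous (fun p : (Fin m → ℝ) × (Fin n → ℝ) => μ + P *ᵥ p.1 + Q *ᵥ p.2) :=
    (continuous_const.add (Continuous.matrix_mulVec continuous_const continuous_fst)).add
      (Continuous.matrix_mulVec continuous_const continuous_snd)
  rw [charFunDual_apply, integral_map he.aemeasurable
    (Continuous.aestronglyMeasurable (by fun_prop))]
  have h : ∀ p : (Fin m → ℝ) × (Fin n → ℝ),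
      Complex.exp (L (μ + P *ᵥ p.1 + Q *ᵥ p.2) * Complex.I)
      = Complex.exp ((w ⬝ᵥ μ : ℝ) * Complex.I)
        * (Complex.exp (((Pᵀ *ᵥ w) ⬝ᵥ p.1 : ℝ) * Complex.I)
          * Complex.exp (((Qᵀ *ᵥ w) ⬝ᵥ p.2 : ℝ) * Complex.I)) := by
    intro p
    rw [hw, dotProduct_add, dotProduct_add, dotProduct_mulVec, dotProduct_mulVec,
      ← mulVec_transpose, ← mulVec_transpose, ← Complex.exp_add, ← Complex.exp_add]
    push_cast
    congr 1
    ring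
  simp_rw [h]
  rw [integral_const_mul,
    integral_prod_mul (fun u => Complex.exp (((Pᵀ *ᵥ w) ⬝ᵥ u : ℝ) * Complex.I))
      (fun u => Complex.exp (((Qᵀ *ᵥ w) ⬝ᵥ u : ℝ) * Complex.I)),
    integral_cexp_dotProduct_stdGaussianPi, integral_cexp_dotProduct_stdGaussianPi,
    ← Complex.exp_add, ← Complex.ofReal_add, add_mulVec, dotProduct_add, ← mulVec_mulVec,
    ← mulVec_mulVec, dotProduct_mulVec w, dotProduct_mulVec w, ← mulVec_transpose,
    ← mulVec_transpose]
  congr 3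
  ring

/-- An affine image of a product of standard Gaussians is determined by its mean and covariance. -/
lemma map_affine_prod_stdGaussianPi {m n k : ℕ} (μ : Fin k → ℝ)
    (P : Matrix (Fin k) (Fin m) ℝ) (Q : Matrix (Fin k) (Fin n) ℝ)
    (R : Matrix (Fin k) (Fin k) ℝ) (h : P * Pᵀ + Q * Qᵀ = R * Rᵀ) :
    ((stdGaussianPi m).prod (stdGaussianPi n)).map (fun p => μ + P *ᵥ p.1 + Q *ᵥ p.2)
      = (stdGaussianPi k).map (fun u => μ + R *ᵥ u) := by
  refine Measure.ext_of_charFunDual (funext fun L => ?_)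
  have hw := strongDual_pi_apply_eq_dotProduct L
  rw [charFunDual_map_affine_prod_stdGaussianPi μ P Q L _ hw,
    charFunDual_map_affine_stdGaussianPi μ R L _ hw, h]

/-- Correctness of the linear randomize-then-optimize sampler (appendix B):
if `L₁L₁ᵀ = Σ_obs⁻¹` and `L₂L₂ᵀ = Σ_pr⁻¹`, then the pushforward under
`T(ζ,γ) = Σpo (AᵀΣ_obs⁻¹y + Σ_pr⁻¹μ_pr + AᵀL₁ζ + L₂γ)` of the product of the
standard Gaussian measures on `ℝ^m` and `ℝ^d` is the Gaussian measure
`N(μpo, Σpo)`, given by its Lebesgue density. -/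
theorem linear_rto_correct
    (d m : ℕ) (hd : 0 < d) (hm : 0 < m)
    (A : Matrix (Fin m) (Fin d) ℝ)
    (Sobs : Matrix (Fin m) (Fin m) ℝ) (hSobs : Sobs.PosDef)
    (Spr : Matrix (Fin d) (Fin d) ℝ) (hSpr : Spr.PosDef)
    (μpr : Fin d → ℝ) (y : Fin m → ℝ)
    (Spo : Matrix (Fin d) (Fin d) ℝ)
    (hSpo : Spo = (Aᵀ * Sobs⁻¹ * A + Spr⁻¹)⁻¹)
    (μpo : Fin d → ℝ)
    (hμpo : μpo = Spo.mulVec (Aᵀ.mulVec (Sobs⁻¹.mulVec y) + Spr⁻¹.mulVec μpr))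
    (L1 : Matrix (Fin m) (Fin m) ℝ) (hL1 : L1 * L1ᵀ = Sobs⁻¹)
    (L2 : Matrix (Fin d) (Fin d) ℝ) (hL2 : L2 * L2ᵀ = Spr⁻¹) :
    Measure.map
      (fun ζγ : (Fin m → ℝ) × (Fin d → ℝ) =>
        Spo.mulVec (Aᵀ.mulVec (Sobs⁻¹.mulVec y) + Spr⁻¹.mulVec μpr
          + Aᵀ.mulVec (L1.mulVec ζγ.1) + L2.mulVec ζγ.2))
      ((volume.withDensity (fun u : Fin m → ℝ =>
          ENNReal.ofReal ((2 * Real.pi) ^ (-(m : ℝ) / 2)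
            * Real.exp (-(∑ i, u i ^ 2) / 2)))).prod
        (volume.withDensity (fun u : Fin d → ℝ =>
          ENNReal.ofReal ((2 * Real.pi) ^ (-(d : ℝ) / 2)
            * Real.exp (-(∑ i, u i ^ 2) / 2)))))
    = volume.withDensity (fun x : Fin d → ℝ =>
        ENNReal.ofReal ((2 * Real.pi) ^ (-(d : ℝ) / 2) * Spo.det ^ (-(1 : ℝ) / 2)
          * Real.exp (-(1 / 2) * ((x - μpo) ⬝ᵥ Spo⁻¹.mulVec (x - μpo))))) := by
  have hM : (Aᵀ * Sobs⁻¹ * A + Spr⁻¹).PosDef := by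
    refine PosDef.posSemidef_add ?_ hSpr.inv
    simpa [conjTranspose_eq_transpose_of_trivial] using
      hSobs.inv.posSemidef.conjTranspose_mul_mul_same A
  have hSpo_pd : Spo.PosDef := hSpo ▸ hM.inv
  have hsymm : Spoᵀ = Spo := by
    rw [← conjTranspose_eq_transpose_of_trivial]
    exact hSpo_pd.isHermitian
  obtain ⟨R, hR, hSR⟩ := hSpo_pd.exists_eq_mul_transpose
  have hcov : (Spo * (Aᵀ * L1)) * (Spo * (Aᵀ * L1))ᵀ + (Spo * L2) * (Spo * L2)ᵀ = R * Rᵀ := by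
    have hinv : Spo * (Aᵀ * Sobs⁻¹ * A + Spr⁻¹) = 1 := by
      rw [hSpo]
      exact Matrix.nonsing_inv_mul _ hM.det_pos.ne'.isUnit
    calc _ = Spo * (Aᵀ * (L1 * L1ᵀ) * A + L2 * L2ᵀ) * Spo := by
          simp only [transpose_mul, transpose_transpose, hsymm, mul_add, add_mul, Matrix.mul_assoc]
      _ = R * Rᵀ := by rw [hL1, hL2, hinv, one_mul, hSR]
  have key := map_affine_prod_stdGaussianPi μpo (Spo * (Aᵀ * L1)) (Spo * L2) R hcov
  rw [map_affine_stdGaussianPi μpo R Spo hR hSR] at key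
  rw [← key]
  refine congrArg (fun f => Measure.map f ((stdGaussianPi m).prod (stdGaussianPi d))) ?_
  funext p
  simp only [hμpo, mulVec_add, mulVec_mulVec]
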